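/- Let n ∈ ℕ, let f : ℝ^n → ℝ^n be continuously differentiable, and let u₊, u₋ ∈ ℝ^n satisfy f(u₊) = f(u₋) = 0, where every complex eigenvalue σ of the Jacobian matrices Df(u₊) and Df(u₋) (viewed as complex n×n matrices) satisfies Re σ < 0. Let ū : ℝ → ℝ^n be a C² solution of ū'' + f(ū) = 0 such that ū(x) → u₊ and ū'(x) → 0 as x → +∞, and ū(x) → u₋ and ū'(x) → 0 as x → −∞. Then there exist constants C > 0 and η > 0 such that ‖ū(x) − u₊‖ ≤ C e^{−η x} for all x ≥ 0 and ‖ū(x) − u₋‖ ≤ C e^{−η |x|} for all x ≤ 0. -/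

import Mathlib

open Filter Real

/-- A complex endomorphism whose eigenvalues all have positive real part is coercive with respect
to some (real) inner product. -/
lemma exists_coercive_embedding (d : ℕ) : ∀ (V : Type) [AddCommGroup V] [Module ℂ V]
    [FiniteDimensional ℂ V] (T : Module.End ℂ V), Module.finrank ℂ V = d →
    (∀ μ : ℂ, T.HasEigenvalue μ → 0 < μ.re) →
    ∃ (F : Type) (_ : NormedAddCommGroup F) (_ : InnerProductSpace ℝ F) (L : V →+ F),
      (∀ (a : ℝ) x, L ((a : ℂ) • x) = a • L x) ∧ Function.Injective L ∧
      ∃ c > 0, ∀ x, c * ‖L x‖ ^ 2 ≤ inner ℝ (L x) (L (T x)) := by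
  induction d with
  | zero =>
    intro V _ _ _ T hd _
    have : Subsingleton V := Module.finrank_zero_iff.mp hd
    exact ⟨ℝ, inferInstance, inferInstance, 0, by simp, Function.injective_of_subsingleton _,
      1, one_pos, by simp⟩
  | succ d ih =>
    intro V _ _ _ T hd hT
    have : Nontrivial V := Module.nontrivial_of_finrank_pos (R := ℂ) (by omega)
    obtain ⟨l, hl⟩ := Module.End.exists_eigenvalue (K := ℂ) (V := Module.Dual ℂ V) T.dualMap
    obtain ⟨ℓ, hℓ⟩ := hl.exists_hasEigenvector
    have hℓT : ∀ x, ℓ (T x) = l * ℓ x := fun x => by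
      simpa using LinearMap.congr_fun hℓ.apply_eq_smul x
    obtain ⟨v₀, hv₀⟩ : ∃ v, ℓ v ≠ 0 := by
      by_contra! h
      exact hℓ.2 (LinearMap.ext h)
    obtain ⟨v, hv⟩ : ∃ v, ℓ v = 1 := ⟨(ℓ v₀)⁻¹ • v₀, by simp [hv₀]⟩
    have hlT : T.HasEigenvalue l := by
      rw [Module.End.hasEigenvalue_iff_mem_spectrum, spectrum.mem_iff]
      intro h
      obtain ⟨w, hw⟩ := ((Module.End.isUnit_iff _).mp h).2 v
      have := congrArg ℓ hw
      simp [hℓT, hv, Module.algebraMap_end_apply] at this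
    have hr : 0 < l.re := hT l hlT
    have hmaps : ∀ x ∈ LinearMap.ker ℓ, T x ∈ LinearMap.ker ℓ := fun x hx => by
      simp only [LinearMap.mem_ker] at hx ⊢
      rw [hℓT, hx, mul_zero]
    have hrank : Module.finrank ℂ (LinearMap.ker ℓ) = d := by
      have h1 := LinearMap.finrank_range_add_finrank_ker ℓ
      have h2 : LinearMap.range ℓ = ⊤ := LinearMap.range_eq_top.mpr fun z => ⟨z • v, by simp [hv]⟩
      rw [h2, finrank_top, Module.finrank_self] at h1
      omega
    obtain ⟨F, _, _, L, hLs, hLi, c, hc, hL⟩ := ih (LinearMap.ker ℓ) (T.restrict hmaps) hrank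
      (fun μ hμ => by
        obtain ⟨w, hw⟩ := hμ.exists_hasEigenvector
        refine hT μ (Module.End.hasEigenvalue_of_hasEigenvector (x := (w : V)) ?_)
        refine ⟨Module.End.mem_eigenspace_iff.mpr ?_, by simpa using hw.2⟩
        simpa using congrArg Subtype.val hw.apply_eq_smul)
    let p : V →ₗ[ℂ] LinearMap.ker ℓ :=
      (LinearMap.id - ℓ.smulRight v).codRestrict _ (fun x => by simp [hv])
    have hp : ∀ x, (p x : V) = x - ℓ x • v := fun x => rfl
    let u : LinearMap.ker ℓ := ⟨T v - l • v, by simp [hℓT, hv]⟩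
    have hpT : ∀ x, p (T x) = T.restrict hmaps (p x) + ℓ x • u := fun x => by
      apply Subtype.ext
      simp only [hp, hℓT, Submodule.coe_add, LinearMap.coe_restrict_apply, Submodule.coe_smul, u,
        map_sub, map_smul, smul_sub, mul_smul]
      rw [smul_comm l]
      abel
    -- the image of the complex multiples of `u` is controlled by two real directions
    let K : ℝ := ‖L u‖ + ‖L (Complex.I • u)‖
    have hK : ∀ z : ℂ, ‖L (z • u)‖ ≤ ‖z‖ * K := fun z => by
      have : z • u = (z.re : ℂ) • u + (z.im : ℂ) • (Complex.I • u) := by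
        rw [smul_smul, ← add_smul, Complex.re_add_im]
      rw [this, map_add, hLs, hLs]
      refine (norm_add_le _ _).trans ?_
      rw [norm_smul, norm_smul, mul_add]
      gcongr
      · exact Complex.abs_re_le_norm z
      · exact Complex.abs_im_le_norm z
    have hK0 : 0 ≤ K := by positivity
    let M : ℝ := 1 + K ^ 2 / (c * l.re)
    have hM1 : 1 ≤ M := le_add_of_nonneg_right (by positivity)
    have hM2 : K ^ 2 ≤ c * l.re * M ^ 2 := by
      have h1 : c * l.re * M = c * l.re + K ^ 2 := by
        simp only [M]; field_simp
      have h2 : 0 < c * l.re := by positivity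
      nlinarith [mul_le_mul_of_nonneg_left hM1 h2.le, mul_pos h2 (by linarith : 0 < M)]
    let N : V →+ WithLp 2 (F × ℂ) :=
      AddMonoidHom.mk' (fun x => WithLp.toLp 2 (L (p x), M • ℓ x)) fun x y => by
        rw [← WithLp.toLp_add, Prod.mk_add_mk, map_add, map_add, map_add, smul_add]
    have hN : ∀ x, N x = WithLp.toLp 2 (L (p x), M • ℓ x) := fun x => rfl
    refine ⟨WithLp 2 (F × ℂ), inferInstance, inferInstance, N, ?_, ?_, min (c / 2) (l.re / 2),
      by positivity, ?_⟩
    · intro a x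
      rw [hN, hN, ← WithLp.toLp_smul, Prod.smul_mk, map_smul p, map_smul ℓ, hLs, Complex.coe_smul,
        smul_comm]
    · rw [injective_iff_map_eq_zero]
      intro x hx
      have h1 : L (p x) = 0 := congrArg (fun y => (WithLp.ofLp y).1) hx
      have h2 : M • ℓ x = 0 := congrArg (fun y => (WithLp.ofLp y).2) hx
      have h3 : p x = 0 := hLi (h1.trans (map_zero L).symm)
      have h4 : ℓ x = 0 := (smul_eq_zero.mp h2).resolve_left (by positivity)
      have h5 := hp x
      rw [h3, h4] at h5
      simpa using h5.symm
    · intro x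
      simp only [hN, WithLp.prod_inner_apply,
        WithLp.prod_norm_sq_eq_of_L2, WithLp.toLp_fst, WithLp.toLp_snd, hpT, map_add, inner_add_right,
        norm_smul, hℓT, inner_smul_left, inner_smul_right]
      have h1 := hL (p x)
      have h2 : -(‖L (p x)‖ * (‖ℓ x‖ * K)) ≤ inner ℝ (L (p x)) (L (ℓ x • u)) := by
        refine (neg_le_neg ?_).trans (neg_le_of_abs_le (abs_real_inner_le_norm _ _))
        gcongr
        exact hK _
      have h3 : inner ℝ (ℓ x) (l * ℓ x) = l.re * ‖ℓ x‖ ^ 2 := by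
        rw [Complex.inner, ← Complex.normSq_eq_norm_sq, Complex.normSq_apply]
        simp; ring
      rw [h3]
      simp only [Real.norm_eq_abs, mul_pow, sq_abs, conj_trivial]
      have h4 : min (c / 2) (l.re / 2) * ‖L (p x)‖ ^ 2 ≤ c / 2 * ‖L (p x)‖ ^ 2 := by
        gcongr; exact min_le_left _ _
      have h5 : min (c / 2) (l.re / 2) * (M ^ 2 * ‖ℓ x‖ ^ 2) ≤ l.re / 2 * (M ^ 2 * ‖ℓ x‖ ^ 2) := by
        gcongr; exact min_le_right _ _
      have h6 : ‖L (p x)‖ * (‖ℓ x‖ * K) ≤ c / 2 * ‖L (p x)‖ ^ 2 + l.re / 2 * (M ^ 2 * ‖ℓ x‖ ^ 2) := by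
        have h7 : K ^ 2 * ‖ℓ x‖ ^ 2 ≤ c * l.re * M ^ 2 * ‖ℓ x‖ ^ 2 := by gcongr
        have h8 := sq_nonneg (c * ‖L (p x)‖ - K * ‖ℓ x‖)
        refine le_of_mul_le_mul_left ?_ hc
        nlinarith
      nlinarith

/-- A function with `μ ^ 2 * φ ≤ φ''` on a half-line, vanishing at infinity together
with its derivative, decays exponentially. -/
lemma exp_decay_of_sq_mul_le_deriv2 {φ φ' φ'' : ℝ → ℝ} {μ X : ℝ} (hμ : 0 < μ)
    (h1 : ∀ x, HasDerivAt φ (φ' x) x) (h2 : ∀ x, HasDerivAt φ' (φ'' x) x)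
    (hle : ∀ x ≥ X, μ ^ 2 * φ x ≤ φ'' x)
    (hφ : Tendsto φ atTop (nhds 0)) (hφ' : Tendsto φ' atTop (nhds 0)) :
    ∀ x ≥ X, φ x * exp (μ * x) ≤ φ X * exp (μ * X) := by
  have hexp : ∀ a x : ℝ, HasDerivAt (fun y => exp (a * y)) (exp (a * x) * a) x := fun a x => by
    simpa using ((hasDerivAt_id x).const_mul a).exp
  have key : ∀ x ≥ X, φ' x + μ * φ x ≤ 0 := by
    have hd : ∀ x, HasDerivAt (fun y => (φ' y + μ * φ y) * exp (-μ * y))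
        ((φ'' x + μ * φ' x) * exp (-μ * x) + (φ' x + μ * φ x) * (exp (-μ * x) * -μ)) x :=
      fun x => ((h2 x).add ((h1 x).const_mul μ)).mul (hexp _ x)
    have hmono : MonotoneOn (fun y => (φ' y + μ * φ y) * exp (-μ * y)) (Set.Ici X) := by
      refine monotoneOn_of_hasDerivWithinAt_nonneg (convex_Ici X)
        (fun x _ => (hd x).continuousAt.continuousWithinAt)
        (fun x _ => (hd x).hasDerivWithinAt) fun x hx => ?_
      rw [interior_Ici] at hx
      have := mul_nonneg (sub_nonneg.mpr (hle x hx.le)) (exp_pos (-μ * x)).le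
      linarith
    have hlim : Tendsto (fun y => (φ' y + μ * φ y) * exp (-μ * y)) atTop (nhds 0) := by
      have he : Tendsto (fun y => exp (-μ * y)) atTop (nhds 0) :=
        tendsto_exp_atBot.comp (tendsto_id.const_mul_atTop_of_neg (by linarith))
      simpa using (hφ'.add (hφ.const_mul μ)).mul he
    intro x hx
    have h : (φ' x + μ * φ x) * exp (-μ * x) ≤ 0 :=
      ge_of_tendsto hlim ((eventually_ge_atTop x).mono fun y hy =>
        hmono hx (hx.le.trans hy : X ≤ y) hy)
    exact nonpos_of_mul_nonpos_left h (exp_pos _)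
  have hd : ∀ x, HasDerivAt (fun y => φ y * exp (μ * y))
      (φ' x * exp (μ * x) + φ x * (exp (μ * x) * μ)) x := fun x => (h1 x).mul (hexp _ x)
  have hanti : AntitoneOn (fun y => φ y * exp (μ * y)) (Set.Ici X) := by
    refine antitoneOn_of_hasDerivWithinAt_nonpos (convex_Ici X)
      (fun x _ => (hd x).continuousAt.continuousWithinAt)
      (fun x _ => (hd x).hasDerivWithinAt) fun x hx => ?_
    rw [interior_Ici] at hx
    have := mul_nonneg (neg_nonneg.mpr (key x hx.le)) (exp_pos (μ * x)).le
    linarith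
  exact fun x hx => hanti (Set.self_mem_Ici) hx hx

/-- Exponential decay on a half-line for solutions of `w'' + f w = 0` converging to a zero of `f`
at which `-Df` is coercive for the inner product pulled back along `G`. -/
lemma exp_decay_of_coercive {E F : Type*} [NormedAddCommGroup E] [NormedSpace ℝ E]
    [FiniteDimensional ℝ E] [NormedAddCommGroup F] [InnerProductSpace ℝ F]
    {f : E → E} {p : E} {A : E →L[ℝ] E} (hf : HasFDerivAt f A p) (hfp : f p = 0)
    (G : E →L[ℝ] F) (hG : Function.Injective G) {c : ℝ} (hc : 0 < c)
    (hcoer : ∀ x, c * ‖G x‖ ^ 2 ≤ inner ℝ (G x) (G (-A x)))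
    {u u' : ℝ → E} (hu : ∀ x, HasDerivAt u (u' x) x) (hu' : ∀ x, HasDerivAt u' (-f (u x)) x)
    (hlim : Tendsto u atTop (nhds p)) (hlim' : Tendsto u' atTop (nhds 0)) :
    ∃ C > 0, ∃ η > 0, ∀ x, 0 ≤ x → ‖u x - p‖ ≤ C * exp (-η * x) := by
  obtain ⟨k, hk, hGk⟩ : ∃ k > 0, ∀ x, ‖x‖ ≤ k * ‖G x‖ := by
    obtain ⟨K, hK, h⟩ := (G : E →ₗ[ℝ] F).exists_antilipschitzWith (LinearMap.ker_eq_bot.mpr hG)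
    exact ⟨K, hK, fun x => by simpa using h.le_mul_dist x 0⟩
  have hlin : ∀ᶠ x in atTop, ‖f (u x) - A (u x - p)‖ ≤ c / (2 * k * (‖G‖ + 1)) * ‖u x - p‖ := by
    have := hlim.eventually (hf.isLittleO.def (c := c / (2 * k * (‖G‖ + 1))) (by positivity))
    simpa [hfp] using this
  obtain ⟨X, hX⟩ := eventually_atTop.mp hlin
  have hGu : ∀ x, HasDerivAt (fun y => G (u y - p)) (G (u' x)) x := fun x =>
    G.hasFDerivAt.comp_hasDerivAt x ((hu x).sub_const p)
  have hGu' : ∀ x, HasDerivAt (fun y => G (u' y)) (G (-f (u x))) x := fun x =>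
    G.hasFDerivAt.comp_hasDerivAt x (hu' x)
  have ht : Tendsto (fun y => G (u y - p)) atTop (nhds 0) := by
    have h := (G.continuous.tendsto _).comp (hlim.sub_const p)
    rwa [sub_self, map_zero] at h
  have ht' : Tendsto (fun y => G (u' y)) atTop (nhds 0) := by
    have h := (G.continuous.tendsto _).comp hlim'
    rwa [map_zero] at h
  have hdecay := exp_decay_of_sq_mul_le_deriv2 (X := X) (Real.sqrt_pos.mpr hc)
    (fun x => (hGu x).inner ℝ (hGu x))
    (fun x => ((hGu x).inner ℝ (hGu' x)).add ((hGu' x).inner ℝ (hGu x)))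
    (fun x hx => by
      rw [Real.sq_sqrt hc.le, real_inner_self_eq_norm_sq, real_inner_self_eq_norm_sq,
        real_inner_comm (G (u x - p))]
      have h1 := hcoer (u x - p)
      have h2 : G (-f (u x)) = G (-A (u x - p)) - G (f (u x) - A (u x - p)) := by
        rw [← map_sub]; congr 1; abel
      have h3 : inner ℝ (G (u x - p)) (G (f (u x) - A (u x - p))) ≤ c / 2 * ‖G (u x - p)‖ ^ 2 := by
        refine (real_inner_le_norm _ _).trans ?_
        calc ‖G (u x - p)‖ * ‖G (f (u x) - A (u x - p))‖
            ≤ ‖G (u x - p)‖ * ((‖G‖ + 1) *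
                (c / (2 * k * (‖G‖ + 1)) * (k * ‖G (u x - p)‖))) := by
              gcongr
              refine (G.le_opNorm _).trans ?_
              gcongr
              · linarith
              · exact (hX x hx).trans (by gcongr; exact hGk _)
          _ = c / 2 * ‖G (u x - p)‖ ^ 2 := by
              have : ‖G‖ + 1 ≠ 0 := by positivity
              field_simp
      rw [h2, inner_sub_right]
      nlinarith [sq_nonneg ‖G (u' x)‖])
    (by simpa only [inner_zero_left] using ht.inner (𝕜 := ℝ) ht)
    (by simpa only [inner_zero_left, add_zero] using
      (ht.inner (𝕜 := ℝ) ht').add (ht'.inner (𝕜 := ℝ) ht))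
  obtain ⟨η, hη, hημ⟩ : ∃ η > 0, √c = 2 * η := ⟨√c / 2, by positivity, by ring⟩
  rw [hημ] at hdecay
  have hcont : Continuous u := continuous_iff_continuousAt.mpr fun x => (hu x).continuousAt
  obtain ⟨D, hD⟩ := (isCompact_Icc (a := 0) (b := X)).exists_bound_of_continuousOn
    (f := fun x => exp (η * x) • (u x - p)) (by fun_prop)
  refine ⟨max (max D (k * (‖G (u X - p)‖ * exp (η * X)))) 1, by positivity, η, hη,
    fun x hx => ?_⟩
  rw [neg_mul, exp_neg, ← div_eq_mul_inv, le_div_iff₀ (exp_pos _)]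
  refine le_trans ?_ (le_max_left _ _)
  rcases le_total x X with h | h
  · refine le_trans (le_of_eq ?_) ((hD x ⟨hx, h⟩).trans (le_max_left _ _))
    rw [norm_smul, Real.norm_eq_abs, abs_of_pos (exp_pos _), mul_comm]
  · refine le_trans ?_ (le_max_right _ _)
    have h1 : ‖G (u x - p)‖ * exp (η * x) ≤ ‖G (u X - p)‖ * exp (η * X) := by
      refine le_of_sq_le_sq ?_ (by positivity)
      have := hdecay x h
      simp only [real_inner_self_eq_norm_sq] at this
      simpa only [mul_pow, ← exp_nat_mul, Nat.cast_ofNat, mul_assoc] using this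
    calc ‖u x - p‖ * exp (η * x) ≤ k * ‖G (u x - p)‖ * exp (η * x) := by gcongr; exact hGk _
      _ ≤ _ := by rw [mul_assoc]; gcongr

/-- Exponential decay on a half-line for solutions of `u'' + f u = 0` converging to a rest state
at which the Jacobian has spectrum in the open left half-plane. -/
lemma exp_decay_of_spectrum {n : ℕ} {f : (Fin n → ℝ) → Fin n → ℝ} {p : Fin n → ℝ}
    {A : (Fin n → ℝ) →L[ℝ] (Fin n → ℝ)} (hf : HasFDerivAt f A p) (hfp : f p = 0)
    (hspec : ∀ σ ∈ spectrum ℂ ((LinearMap.toMatrix' A.toLinearMap).map (algebraMap ℝ ℂ)), σ.re < 0)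
    {u u' : ℝ → Fin n → ℝ} (hu : ∀ x, HasDerivAt u (u' x) x)
    (hu' : ∀ x, HasDerivAt u' (-f (u x)) x)
    (hlim : Tendsto u atTop (nhds p)) (hlim' : Tendsto u' atTop (nhds 0)) :
    ∃ C > 0, ∃ η > 0, ∀ x, 0 ≤ x → ‖u x - p‖ ≤ C * exp (-η * x) := by
  set B := (LinearMap.toMatrix' A.toLinearMap).map (algebraMap ℝ ℂ) with hB
  obtain ⟨F, _, _, L, hLs, hLi, c, hc, hL⟩ := exists_coercive_embedding _ (Fin n → ℂ)
    (-Matrix.toLin' B) rfl (fun μ hμ => by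
      rw [Module.End.hasEigenvalue_iff_mem_spectrum, ← spectrum.neg_eq, Set.mem_neg,
        Matrix.spectrum_toLin'] at hμ
      simpa using hspec _ hμ)
  let G : (Fin n → ℝ) →ₗ[ℝ] F :=
    { toFun := fun x => L (fun i => (x i : ℂ))
      map_add' := fun x y => by
        rw [← map_add]; congr 1; ext i; simp
      map_smul' := fun a x => by
        rw [RingHom.id_apply, ← hLs]; congr 1; ext i; simp }
  refine exp_decay_of_coercive hf hfp G.toContinuousLinearMap ?_ hc ?_ hu hu' hlim hlim'
  · intro x y hxy
    ext i
    exact_mod_cast congrFun (hLi hxy) i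
  · intro x
    have h : (-Matrix.toLin' B) (fun i => (x i : ℂ)) = fun i => (((-A x) i : ℝ) : ℂ) := by
      ext i
      have h1 : A x = (LinearMap.toMatrix' A.toLinearMap).mulVec x := by
        rw [LinearMap.toMatrix'_mulVec]; rfl
      rw [h1]
      simp [-LinearMap.toMatrix'_mulVec, -LinearMap.toMatrix'_apply, hB, Matrix.mulVec, dotProduct]
    have h2 := hL (fun i => (x i : ℂ))
    rwa [h] at h2



/-- Exponential convergence of a reaction-diffusion front profile to its end states,
under the hypothesis that all complex eigenvalues of the Jacobians `Df(u±)`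
have strictly negative real part. -/
theorem front_profile_exponential_decay
    (n : ℕ) (f : (Fin n → ℝ) → Fin n → ℝ) (hf : ContDiff ℝ 1 f)
    (uP uM : Fin n → ℝ) (hfp : f uP = 0) (hfm : f uM = 0)
    (hspecP : ∀ σ ∈ spectrum ℂ
      ((LinearMap.toMatrix' (fderiv ℝ f uP).toLinearMap).map (algebraMap ℝ ℂ)), σ.re < 0)
    (hspecM : ∀ σ ∈ spectrum ℂ
      ((LinearMap.toMatrix' (fderiv ℝ f uM).toLinearMap).map (algebraMap ℝ ℂ)), σ.re < 0)
    (ubar : ℝ → Fin n → ℝ) (hubar : ContDiff ℝ 2 ubar)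
    (hode : ∀ x : ℝ, iteratedDeriv 2 ubar x + f (ubar x) = 0)
    (hlimP : Tendsto ubar atTop (nhds uP))
    (hlimP' : Tendsto (deriv ubar) atTop (nhds (0 : Fin n → ℝ)))
    (hlimM : Tendsto ubar atBot (nhds uM))
    (hlimM' : Tendsto (deriv ubar) atBot (nhds (0 : Fin n → ℝ))) :
    ∃ C > (0 : ℝ), ∃ η > (0 : ℝ),
      (∀ x : ℝ, 0 ≤ x → ‖ubar x - uP‖ ≤ C * Real.exp (-η * x)) ∧
      (∀ x : ℝ, x ≤ 0 → ‖ubar x - uM‖ ≤ C * Real.exp (-η * |x|)) := by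
  have hu : ∀ x, HasDerivAt ubar (deriv ubar x) x := fun x =>
    (hubar.differentiable (by norm_num) x).hasDerivAt
  have hu' : ∀ x, HasDerivAt (deriv ubar) (-f (ubar x)) x := fun x => by
    have h : Differentiable ℝ (deriv ubar) := by
      simpa using hubar.differentiable_iteratedDeriv 1 (by norm_num)
    have h2 : deriv (deriv ubar) x = -f (ubar x) := by
      rw [← eq_neg_of_add_eq_zero_left (hode x), iteratedDeriv_succ, iteratedDeriv_one]
    exact h2 ▸ (h x).hasDerivAt
  have hdf : ∀ p, HasFDerivAt f (fderiv ℝ f p) p := fun p =>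
    (hf.differentiable one_ne_zero p).hasFDerivAt
  obtain ⟨C₁, hC₁, η₁, hη₁, h₁⟩ :=
    exp_decay_of_spectrum (hdf uP) hfp hspecP hu hu' hlimP hlimP'
  obtain ⟨C₂, hC₂, η₂, hη₂, h₂⟩ :=
    exp_decay_of_spectrum (u := fun x => ubar (-x)) (u' := fun x => -deriv ubar (-x))
      (hdf uM) hfm hspecM
      (fun x => by
        simpa [Function.comp_def] using (hu (-x)).scomp x (hasDerivAt_neg x))
      (fun x => by
        simpa [Function.comp_def, Pi.neg_def] using ((hu' (-x)).scomp x (hasDerivAt_neg x)).neg)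
      (hlimM.comp tendsto_neg_atTop_atBot)
      (by simpa using (hlimM'.comp tendsto_neg_atTop_atBot).neg)
  refine ⟨max C₁ C₂, by positivity, min η₁ η₂, by positivity, fun x hx => ?_, fun x hx => ?_⟩
  · refine (h₁ x hx).trans ?_
    gcongr
    · exact le_max_left _ _
    · exact min_le_left _ _
  · rw [abs_of_nonpos hx]
    have hx' : 0 ≤ -x := neg_nonneg.mpr hx
    have h := h₂ (-x) hx'
    rw [neg_neg] at h
    refine h.trans ?_
    gcongr
    · exact le_max_right _ _
    · exact min_le_right _ _
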